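/- arXiv:1801.06749 — 2 statements merged into one kernel-verified Lean document; each statement's English description precedes it below -/
import Mathlib

section
/- Let X be a complex Banach space, (T(t))_{t≥0} a bounded C₀-semigroup on X with M := sup_{t≥0} ‖T(t)‖. For each t > 0 let ν_t be a Borel probability measure on [0,∞) with ∫₀^∞ s dν_t(s) = 1 and σ_t² := ∫₀^∞ s² dν_t(s) < ∞, and for n ≥ 1 define the bounded operator P_{t,n} on X by P_{t,n} x = ∫₀^∞ T(ts/n) x dν_t(s) (Bochner integral). Suppose x, y ∈ X satisfy T(u)x = x − ∫₀ᵘ T(v)y dv for all u ≥ 0 (i.e. x ∈ dom(A), y = Ax for the generator −A). Then for all t > 0 and all positive integers n: ‖ P_{t,n}ⁿ x − T(t) x ‖ ≤ M (σ_t² − 1)^{1/2} t n^{−1/2} ‖y‖. -/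
open MeasureTheory Real Set Filter

theorem memLp_id_conv {μ ρ : Measure ℝ} [IsProbabilityMeasure μ] [IsProbabilityMeasure ρ]
    (hμ : MemLp id 2 μ) (hρ : MemLp id 2 ρ) : MemLp id 2 (μ.conv ρ) := by
  rw [Measure.conv, memLp_map_measure_iff (by fun_prop) (by fun_prop)]
  exact (hμ.comp_fst ρ).add (hρ.comp_snd μ)

theorem integral_id_conv {μ ρ : Measure ℝ} [IsProbabilityMeasure μ] [IsProbabilityMeasure ρ]
    (hμ : MemLp id 2 μ) (hρ : MemLp id 2 ρ) :
    ∫ s, s ∂(μ.conv ρ) = ∫ s, s ∂μ + ∫ s, s ∂ρ := by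
  have iμ : Integrable (fun s : ℝ => s) μ := hμ.integrable (by norm_num)
  have iρ : Integrable (fun s : ℝ => s) ρ := hρ.integrable (by norm_num)
  have i : Integrable (fun s : ℝ => s) (μ.conv ρ) :=
    (memLp_id_conv hμ hρ).integrable (by norm_num)
  rw [integral_conv i]
  simp only [integral_add (integrable_const _) iρ, integral_const, probReal_univ, one_smul]
  rw [integral_add iμ (integrable_const _)]
  simp

theorem variance_id_conv {μ ρ : Measure ℝ} [IsProbabilityMeasure μ] [IsProbabilityMeasure ρ]
    (hμ : MemLp id 2 μ) (hρ : MemLp id 2 ρ) :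
    ProbabilityTheory.variance id (μ.conv ρ) =
      ProbabilityTheory.variance id μ + ProbabilityTheory.variance id ρ := by
  rw [Measure.conv, ProbabilityTheory.variance_id_map (by fun_prop)]
  simpa using ProbabilityTheory.variance_add_prod hμ hρ

theorem ae_nonneg_conv {μ ρ : Measure ℝ} [IsProbabilityMeasure μ] [IsProbabilityMeasure ρ]
    (hμ : ∀ᵐ s ∂μ, 0 ≤ s) (hρ : ∀ᵐ s ∂ρ, 0 ≤ s) : ∀ᵐ s ∂(μ.conv ρ), 0 ≤ s := by
  rw [Measure.conv, ae_map_iff (by fun_prop) measurableSet_Ici]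
  filter_upwards [Measure.quasiMeasurePreserving_fst.ae hμ,
    Measure.quasiMeasurePreserving_snd.ae hρ] with p h₁ h₂
  exact add_nonneg h₁ h₂

/-- The mean absolute deviation is at most the standard deviation. -/
theorem integral_abs_sub_mean_le_sqrt_variance {μ : Measure ℝ} [IsProbabilityMeasure μ]
    (hμ : MemLp id 2 μ) :
    ∫ s, |s - ∫ r, r ∂μ| ∂μ ≤ √(ProbabilityTheory.variance id μ) := by
  have h : MemLp (fun s : ℝ => |s - ∫ r, r ∂μ|) 2 μ := (hμ.sub (memLp_const _)).abs
  have h₀ := ProbabilityTheory.variance_nonneg (fun s : ℝ => |s - ∫ r, r ∂μ|) μ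
  rw [ProbabilityTheory.variance_eq_sub h] at h₀
  refine Real.le_sqrt_of_sq_le ?_
  rw [ProbabilityTheory.variance_eq_integral (by fun_prop)]
  simpa using h₀

section Semigroup

variable {X : Type*} [NormedAddCommGroup X] [NormedSpace ℂ X]
  {T : ℝ → X →L[ℂ] X} {M : ℝ}

theorem integrable_orbit
    (hTcont : ∀ x : X, ContinuousOn (fun t => T t x) (Set.Ici 0))
    (hM : ∀ t : ℝ, 0 ≤ t → ‖T t‖ ≤ M)
    {μ : Measure ℝ} [IsFiniteMeasure μ] (hμ : ∀ᵐ s ∂μ, 0 ≤ s) (v : X) :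
    Integrable (fun s => T s v) μ := by
  have hr : μ.restrict (Set.Ici 0) = μ := Measure.restrict_eq_self_of_ae_mem hμ
  refine Integrable.of_bound (C := M * ‖v‖) ?_ ?_
  · rw [← hr]
    exact (hTcont v).aestronglyMeasurable measurableSet_Ici
  · filter_upwards [hμ] with s hs
    exact (T s).le_of_opNorm_le (hM s hs) v

/-- Subordination turns convolution of measures into composition of operators. -/
theorem integral_orbit_conv [CompleteSpace X]
    (hTadd : ∀ s t : ℝ, 0 ≤ s → 0 ≤ t → T (s + t) = (T s).comp (T t))
    (hTcont : ∀ x : X, ContinuousOn (fun t => T t x) (Set.Ici 0))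
    (hM : ∀ t : ℝ, 0 ≤ t → ‖T t‖ ≤ M)
    {μ ρ : Measure ℝ} [IsProbabilityMeasure μ] [IsProbabilityMeasure ρ]
    (hμ : ∀ᵐ s ∂μ, 0 ≤ s) (hρ : ∀ᵐ s ∂ρ, 0 ≤ s) (v : X) :
    ∫ s, T s v ∂(μ.conv ρ) = ∫ s, T s (∫ r, T r v ∂ρ) ∂μ := by
  rw [integral_conv (integrable_orbit hTcont hM (ae_nonneg_conv hμ hρ) v)]
  refine integral_congr_ae ?_
  filter_upwards [hμ] with s hs
  rw [← (T s).integral_comp_comm (integrable_orbit hTcont hM hρ v)]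
  refine integral_congr_ae ?_
  filter_upwards [hρ] with r hr
  simp [hTadd s r hs hr]

/-- The iterates of a subordinated operator are subordinated to a probability measure whose
mean and variance grow linearly. -/
theorem exists_measure_iterate_integral_orbit [CompleteSpace X]
    (hT0 : T 0 = 1)
    (hTadd : ∀ s t : ℝ, 0 ≤ s → 0 ≤ t → T (s + t) = (T s).comp (T t))
    (hTcont : ∀ x : X, ContinuousOn (fun t => T t x) (Set.Ici 0))
    (hM : ∀ t : ℝ, 0 ≤ t → ‖T t‖ ≤ M)
    {ρ : Measure ℝ} [IsProbabilityMeasure ρ]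
    (hρ : ∀ᵐ s ∂ρ, 0 ≤ s) (hρ2 : MemLp id 2 ρ) (v : X) (n : ℕ) :
    ∃ μ : Measure ℝ, IsProbabilityMeasure μ ∧ (∀ᵐ s ∂μ, 0 ≤ s) ∧ MemLp id 2 μ ∧
      ∫ s, s ∂μ = n * ∫ s, s ∂ρ ∧
      ProbabilityTheory.variance id μ = n * ProbabilityTheory.variance id ρ ∧
      (fun w : X => ∫ s, T s w ∂ρ)^[n] v = ∫ s, T s v ∂μ := by
  induction n with
  | zero =>
    refine ⟨Measure.dirac 0, inferInstance, ?_, ?_, ?_, ?_, ?_⟩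
    · simp [ae_dirac_eq]
    · exact (memLp_const (0 : ℝ)).ae_eq (by simp [ae_dirac_eq, Filter.EventuallyEq])
    · simp
    · simp
    · simp [hT0]
  | succ n ih =>
    obtain ⟨μ, hprob, hpos, hμ2, hmean, hvar, hiter⟩ := ih
    refine ⟨ρ.conv μ, inferInstance, ae_nonneg_conv hρ hpos, memLp_id_conv hρ2 hμ2, ?_, ?_, ?_⟩
    · rw [integral_id_conv hρ2 hμ2, hmean]
      push_cast
      ring
    · rw [variance_id_conv hρ2 hμ2, hvar]
      push_cast
      ring
    · rw [Function.iterate_succ_apply', hiter, integral_orbit_conv hTadd hTcont hM hρ hpos]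

/-- Orbits of points in the domain of the generator are Lipschitz. -/
theorem norm_orbit_sub_le
    (hTcont : ∀ x : X, ContinuousOn (fun t => T t x) (Set.Ici 0))
    (hM : ∀ t : ℝ, 0 ≤ t → ‖T t‖ ≤ M) {x y : X}
    (hx : ∀ u : ℝ, 0 ≤ u → T u x = x - ∫ v in (0 : ℝ)..u, T v y)
    {s t : ℝ} (hs : 0 ≤ s) (ht : 0 ≤ t) :
    ‖T s x - T t x‖ ≤ M * ‖y‖ * |s - t| := by
  have hi : ∀ u : ℝ, 0 ≤ u → IntervalIntegrable (fun v => T v y) volume 0 u := fun u hu =>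
    ((hTcont y).mono (by rw [Set.uIcc_of_le hu]; exact Set.Icc_subset_Ici_self)).intervalIntegrable
  rw [hx s hs, hx t ht, sub_sub_sub_cancel_left,
    intervalIntegral.integral_interval_sub_left (hi t ht) (hi s hs), abs_sub_comm]
  refine intervalIntegral.norm_integral_le_of_norm_le_const fun v hv => ?_
  have hv0 : 0 ≤ v := (le_min hs ht).trans hv.1.le
  exact (T v).le_of_opNorm_le (hM v hv0) y

end Semigroup

theorem stmt_17
    {X : Type*} [NormedAddCommGroup X] [NormedSpace ℂ X] [CompleteSpace X]
    (T : ℝ → X →L[ℂ] X) (M : ℝ)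
    (hT0 : T 0 = 1)
    (hTadd : ∀ s t : ℝ, 0 ≤ s → 0 ≤ t → T (s + t) = (T s).comp (T t))
    (hTcont : ∀ x : X, ContinuousOn (fun t => T t x) (Set.Ici 0))
    (hM : ∀ t : ℝ, 0 ≤ t → ‖T t‖ ≤ M)
    (ν : ℝ → Measure ℝ)
    (hprob : ∀ t : ℝ, 0 < t → IsProbabilityMeasure (ν t))
    (hsupp : ∀ t : ℝ, 0 < t → (ν t) (Set.Iio 0) = 0)
    (hint1 : ∀ t : ℝ, 0 < t → Integrable (fun s => s) (ν t))
    (hmean : ∀ t : ℝ, 0 < t → (∫ s, s ∂(ν t)) = 1)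
    (hint2 : ∀ t : ℝ, 0 < t → Integrable (fun s => s ^ 2) (ν t))
    (x y : X)
    (hx : ∀ u : ℝ, 0 ≤ u → T u x = x - ∫ v in (0:ℝ)..u, T v y) :
    ∀ t : ℝ, 0 < t → ∀ n : ℕ, 0 < n →
      ‖(fun v : X => ∫ s, T (t * s / n) v ∂(ν t))^[n] x - T t x‖
        ≤ M * Real.sqrt ((∫ s, s ^ 2 ∂(ν t)) - 1) * t / Real.sqrt n * ‖y‖ := by
  intro t ht n hn
  have hn' : (0 : ℝ) < n := Nat.cast_pos.2 hn
  have := hprob t ht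
  have hM0 : 0 ≤ M := (norm_nonneg _).trans (hM 0 le_rfl)
  have hν2 : MemLp id 2 (ν t) :=
    (memLp_two_iff_integrable_sq (by fun_prop)).2 (hint2 t ht)
  have hνpos : ∀ᵐ s ∂(ν t), 0 ≤ s := by
    simpa [ae_iff, Set.Iio] using hsupp t ht
  have hmeas : AEMeasurable (fun s : ℝ => t * s / n) (ν t) := by fun_prop
  set ρ := (ν t).map (fun s => t * s / n) with hρ
  have : IsProbabilityMeasure ρ := Measure.isProbabilityMeasure_map hmeas
  have hρpos : ∀ᵐ s ∂ρ, 0 ≤ s := by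
    rw [hρ, ae_map_iff hmeas measurableSet_Ici]
    filter_upwards [hνpos] with s hs
    positivity
  have hcomm : (fun s : ℝ => t * s / n) = fun s => t / n * id s := by
    ext s
    simp only [id]
    ring
  have hρ2 : MemLp id 2 ρ := by
    rw [hρ, memLp_map_measure_iff (by fun_prop) hmeas, Function.id_comp, hcomm]
    exact hν2.const_mul (t / n)
  have hρmean : ∫ s, s ∂ρ = t / n := by
    rw [hρ, integral_map hmeas (by fun_prop), hcomm, integral_const_mul]
    simp [hmean t ht]
  have hρvar : ProbabilityTheory.variance id ρ = (t / n) ^ 2 * ((∫ s, s ^ 2 ∂(ν t)) - 1) := by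
    rw [hρ, ProbabilityTheory.variance_id_map hmeas, hcomm,
      ProbabilityTheory.variance_const_mul, ProbabilityTheory.variance_eq_sub hν2]
    simp [hmean t ht]
  have hP : (fun v : X => ∫ s, T (t * s / n) v ∂(ν t)) = fun v => ∫ s, T s v ∂ρ := by
    ext v
    exact (integral_map hmeas (integrable_orbit hTcont hM hρpos v).aestronglyMeasurable).symm
  obtain ⟨μ, hμ, hpos, hμ2, hμmean, hμvar, hiter⟩ :=
    exists_measure_iterate_integral_orbit hT0 hTadd hTcont hM hρpos hρ2 x n
  have hμmean' : ∫ s, s ∂μ = t := by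
    rw [hμmean, hρmean]
    field_simp
  have hdev := integral_abs_sub_mean_le_sqrt_variance hμ2
  have hsd : √(ProbabilityTheory.variance id μ) = √((∫ s, s ^ 2 ∂(ν t)) - 1) * t / √n := by
    have : ProbabilityTheory.variance id μ = t ^ 2 * ((∫ s, s ^ 2 ∂(ν t)) - 1) / n := by
      rw [hμvar, hρvar]
      field_simp
    rw [this, Real.sqrt_div' _ hn'.le, Real.sqrt_mul (sq_nonneg t), Real.sqrt_sq ht.le, mul_comm t]
  rw [hμmean', hsd] at hdev
  have hint : Integrable (fun s => M * ‖y‖ * |s - t|) μ :=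
    (((hμ2.integrable (by norm_num)).sub (integrable_const t)).abs).const_mul _
  rw [hP, hiter]
  calc ‖∫ s, T s x ∂μ - T t x‖ = ‖∫ s, (T s x - T t x) ∂μ‖ := by
        rw [integral_sub (integrable_orbit hTcont hM hpos x) (integrable_const _)]
        simp
    _ ≤ ∫ s, M * ‖y‖ * |s - t| ∂μ := by
        refine norm_integral_le_of_norm_le hint ?_
        filter_upwards [hpos] with s hs
        exact norm_orbit_sub_le hTcont hM hx hs ht.le
    _ = M * ‖y‖ * ∫ s, |s - t| ∂μ := integral_const_mul _ _
    _ ≤ M * ‖y‖ * (√((∫ s, s ^ 2 ∂(ν t)) - 1) * t / √n) := by gcongr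
    _ = M * Real.sqrt ((∫ s, s ^ 2 ∂(ν t)) - 1) * t / Real.sqrt n * ‖y‖ := by ring
end

section
/- Let X be a complex Banach space, (T(t))_{t≥0} a bounded C₀-semigroup on X with M := sup_{t≥0} ‖T(t)‖. Let ν be a Borel probability measure on [0,∞) with ∫₀^∞ s dν(s) = 1, define the bounded operator P on X by P x = ∫₀^∞ T(s) x dν(s) (Bochner integral), and set L[g] := ∫_{[0,1]} (1−s) dν(s). Suppose x, y ∈ X satisfy T(u)x = x − ∫₀ᵘ T(v)y dv for all u ≥ 0 (i.e. x ∈ dom(A), y = Ax for the generator −A). Then ‖ P x − T(1) x ‖ ≤ 2 M L[g] ‖y‖. -/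
open MeasureTheory Real Set Filter

/-- Mean absolute deviation from `1` of a mean-one probability measure on the half-line. -/
theorem integral_abs_one_sub_eq_two_mul_setIntegral
    (ν : Measure ℝ) [IsProbabilityMeasure ν] (hsupp : ν (Set.Iio 0) = 0)
    (hint : Integrable (fun s => s) ν) (hmean : (∫ s, s ∂ν) = 1) :
    ∫ s, |1 - s| ∂ν = 2 * ∫ s in Set.Icc (0:ℝ) 1, (1 - s) ∂ν := by
  have hi : Integrable (fun s : ℝ => 1 - s) ν := (integrable_const 1).sub hint
  have hzero : ∫ s, (1 - s) ∂ν = 0 := by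
    rw [integral_sub (integrable_const 1) hint, hmean]
    simp
  have hae : ∀ᵐ s ∂ν, |1 - s| = 2 * (Set.Icc (0:ℝ) 1).indicator (fun s => 1 - s) s - (1 - s) := by
    filter_upwards [measure_eq_zero_iff_ae_notMem.mp hsupp] with s hs
    have hs0 : 0 ≤ s := not_lt.mp hs
    by_cases h1 : s ≤ 1
    · rw [indicator_of_mem (show s ∈ Set.Icc (0:ℝ) 1 from ⟨hs0, h1⟩), abs_of_nonneg (by linarith)]
      ring
    · rw [indicator_of_notMem (fun h => h1 h.2), abs_of_nonpos (by linarith)]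
      ring
  rw [integral_congr_ae hae, integral_sub ((hi.indicator measurableSet_Icc).const_mul 2) hi,
    hzero, integral_const_mul, integral_indicator measurableSet_Icc, sub_zero]

theorem stmt_19
    {X : Type*} [NormedAddCommGroup X] [NormedSpace ℂ X] [CompleteSpace X]
    (T : ℝ → X →L[ℂ] X) (M : ℝ)
    (hT0 : T 0 = 1)
    (hTadd : ∀ s t : ℝ, 0 ≤ s → 0 ≤ t → T (s + t) = (T s).comp (T t))
    (hTcont : ∀ x : X, ContinuousOn (fun t => T t x) (Set.Ici 0))
    (hM : ∀ t : ℝ, 0 ≤ t → ‖T t‖ ≤ M)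
    (ν : Measure ℝ) [IsProbabilityMeasure ν]
    (hsupp : ν (Set.Iio 0) = 0)
    (hint : Integrable (fun s => s) ν)
    (hmean : (∫ s, s ∂ν) = 1)
    (x y : X)
    (hx : ∀ u : ℝ, 0 ≤ u → T u x = x - ∫ v in (0:ℝ)..u, T v y) :
    ‖(∫ s, T s x ∂ν) - T 1 x‖ ≤ 2 * M * (∫ s in Set.Icc (0:ℝ) 1, (1 - s) ∂ν) * ‖y‖ := by
  have hdiff : ∀ s : ℝ, 0 ≤ s → ‖T s x - T 1 x‖ ≤ M * ‖y‖ * |1 - s| := by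
    intro s hs
    have hii : ∀ u : ℝ, 0 ≤ u → IntervalIntegrable (fun v => T v y) volume 0 u := fun u hu =>
      ((hTcont y).mono (by rw [uIcc_of_le hu]; exact Icc_subset_Ici_self)).intervalIntegrable
    have heq : T s x - T 1 x = ∫ v in s..1, T v y := by
      rw [hx s hs, hx 1 zero_le_one, sub_sub_sub_cancel_left,
        intervalIntegral.integral_interval_sub_left (hii 1 zero_le_one) (hii s hs)]
    rw [heq]
    refine intervalIntegral.norm_integral_le_of_norm_le_const fun v hv => ?_
    have hv0 : 0 ≤ v := (le_min hs zero_le_one).trans hv.1.le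
    exact (T v).le_of_opNorm_le (hM v hv0) y
  have hnonneg : ∀ᵐ s ∂ν, 0 ≤ s := by
    filter_upwards [measure_eq_zero_iff_ae_notMem.mp hsupp] with s hs using not_lt.mp hs
  have hmeas : AEStronglyMeasurable (fun s => T s x) ν := by
    have h := (hTcont x).aestronglyMeasurable (μ := ν) measurableSet_Ici
    rwa [Measure.restrict_eq_self_of_ae_mem (s := Set.Ici 0) hnonneg] at h
  have horbit : Integrable (fun s => T s x) ν :=
    .of_bound hmeas (M * ‖x‖) (hnonneg.mono fun s hs => (T s).le_of_opNorm_le (hM s hs) x)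
  have hdom : Integrable (fun s : ℝ => M * ‖y‖ * |1 - s|) ν :=
    (((integrable_const 1).sub hint).abs).const_mul _
  calc ‖(∫ s, T s x ∂ν) - T 1 x‖ = ‖∫ s, (T s x - T 1 x) ∂ν‖ := by
        rw [integral_sub horbit (integrable_const _)]
        simp
    _ ≤ ∫ s, M * ‖y‖ * |1 - s| ∂ν := norm_integral_le_of_norm_le hdom (hnonneg.mono hdiff)
    _ = 2 * M * (∫ s in Set.Icc (0:ℝ) 1, (1 - s) ∂ν) * ‖y‖ := by
        rw [integral_const_mul, integral_abs_one_sub_eq_two_mul_setIntegral ν hsupp hint hmean]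
        ring
end
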